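/- arXiv:1510.03086 — 2 statements merged into one kernel-verified Lean document; each statement's English description precedes it below -/
import Mathlib

section
/- Let A be an associative unital algebra over the field ℚ(v), let F, x ∈ A, and suppose x satisfies the l-th order Serre relation with F, i.e. Σ_{t=0}^{l+1} (−1)^{l+1−t} F^{(l+1−t)} x F^{(t)} = 0, where F^{(n)} := (1/[n]!) F^n. Then for every integer n ≥ 0, x F^{(l+1+n)} = Σ_{t=0}^{l} (−1)^{l+t} binom(l+n−t, n) F^{(l+1+n−t)} x F^{(t)}, where binom denotes the quantum binomial coefficient. -/
/-- The quantum integer `[n] = (v^n - v^{-n})/(v - v^{-1})` in `ℚ(v)`. -/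
noncomputable def qint (n : ℤ) : RatFunc ℚ :=
  (RatFunc.X ^ n - RatFunc.X ^ (-n)) / (RatFunc.X - RatFunc.X⁻¹)

/-- The quantum factorial `[n]! = [n][n-1]⋯[1]`, with `[0]! = 1`. -/
noncomputable def qfact (n : ℕ) : RatFunc ℚ :=
  ∏ i ∈ Finset.range n, qint (i + 1)

/-- The quantum binomial coefficient `binom(n, k) = [n][n-1]⋯[n-k+1]/[k]!`
for `n : ℤ` and `k : ℕ`. -/
noncomputable def qbinom (n : ℤ) (k : ℕ) : RatFunc ℚ :=
  (∏ i ∈ Finset.range k, qint (n - i)) / qfact k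

/-- The `n`-th divided power `F^{(n)} = (1/[n]!) F^n` of an element `F`
of a `ℚ(v)`-algebra. -/
noncomputable def dpow {A : Type*} [Ring A] [Algebra (RatFunc ℚ) A]
    (F : A) (n : ℕ) : A :=
  (qfact n)⁻¹ • F ^ n

/-- `x` satisfies the `a`-th order Serre relation with `F`:
`Σ_{t=0}^{a+1} (-1)^{a+1-t} F^{(a+1-t)} x F^{(t)} = 0`. -/
def SerreRel {A : Type*} [Ring A] [Algebra (RatFunc ℚ) A]
    (F x : A) (a : ℕ) : Prop :=
  ∑ t ∈ Finset.range (a + 2),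
      ((-1 : RatFunc ℚ) ^ (a + 1 - t)) • (dpow F (a + 1 - t) * x * dpow F t) = 0

theorem aux_X_pow_ne_one (m : ℕ) (hm : m ≠ 0) : (RatFunc.X : RatFunc ℚ) ^ m ≠ 1 := by
  intro h
  rw [← RatFunc.algebraMap_X, ← map_pow, ← map_one (algebraMap (Polynomial ℚ) (RatFunc ℚ))] at h
  have h2 := RatFunc.algebraMap_injective ℚ h
  have h3 := congrArg Polynomial.natDegree h2
  simp at h3
  exact hm h3

theorem aux_den_ne : (RatFunc.X : RatFunc ℚ) - RatFunc.X⁻¹ ≠ 0 := by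
  intro h
  have hX : (RatFunc.X : RatFunc ℚ) ≠ 0 := RatFunc.X_ne_zero
  apply aux_X_pow_ne_one 2 (by norm_num)
  field_simp at h
  linear_combination h

theorem aux_qint_ne (m : ℕ) : qint ((m : ℤ) + 1) ≠ 0 := by
  have hX : (RatFunc.X : RatFunc ℚ) ≠ 0 := RatFunc.X_ne_zero
  unfold qint
  refine div_ne_zero ?_ aux_den_ne
  intro h
  apply aux_X_pow_ne_one (2 * (m + 1)) (by omega)
  have e : ((m : ℤ) + 1) = ((m + 1 : ℕ) : ℤ) := by push_cast; rfl
  rw [e, zpow_neg, zpow_natCast] at h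
  have hp : (RatFunc.X : RatFunc ℚ) ^ (m + 1) ≠ 0 := pow_ne_zero _ hX
  rw [mul_comm, pow_mul]
  generalize (RatFunc.X : RatFunc ℚ) ^ (m + 1) = y at *
  field_simp at h
  linear_combination h

theorem aux_qint_identity (m t k : ℤ) :
    qint (m + t) * qint (k + m) - qint t * qint k = qint (m + t + k) * qint m := by
  have hX : (RatFunc.X : RatFunc ℚ) ≠ 0 := RatFunc.X_ne_zero
  have hd := aux_den_ne
  unfold qint
  generalize (RatFunc.X : RatFunc ℚ) - RatFunc.X⁻¹ = d at *
  simp only [zpow_add₀ hX, zpow_neg]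
  have hm : (RatFunc.X : RatFunc ℚ) ^ m ≠ 0 := zpow_ne_zero _ hX
  have ht : (RatFunc.X : RatFunc ℚ) ^ t ≠ 0 := zpow_ne_zero _ hX
  have hk : (RatFunc.X : RatFunc ℚ) ^ k ≠ 0 := zpow_ne_zero _ hX
  generalize (RatFunc.X : RatFunc ℚ) ^ m = a at *
  generalize (RatFunc.X : RatFunc ℚ) ^ t = b at *
  generalize (RatFunc.X : RatFunc ℚ) ^ k = c at *
  field_simp
  ring

theorem aux_qfact_succ (n : ℕ) : qfact (n + 1) = qfact n * qint ((n : ℤ) + 1) := by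
  simp [qfact, Finset.prod_range_succ]

theorem aux_qfact_ne (n : ℕ) : qfact n ≠ 0 := by
  unfold qfact
  exact Finset.prod_ne_zero_iff.mpr fun i _ => aux_qint_ne i

theorem aux_qint_zero : qint 0 = 0 := by simp [qint]

theorem aux_qbinom (a b : ℕ) (z : ℤ) (hz : z = (a : ℤ) + b) :
    qbinom z a = qfact (a + b) / (qfact a * qfact b) := by
  have h : qfact (a + b) = qfact b * ∏ i ∈ Finset.range a, qint (z - i) := by
    rw [add_comm, qfact, Finset.prod_range_add, ← qfact, ← Finset.prod_range_reflect]
    congr 1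
    refine Finset.prod_congr rfl fun i hi => ?_
    have := Finset.mem_range.mp hi
    congr 1
    push_cast
    omega
  have := aux_qfact_ne a
  have := aux_qfact_ne b
  rw [h, qbinom]
  field_simp

section
variable {A : Type*} [Ring A] [Algebra (RatFunc ℚ) A]

theorem aux_dpow_succ (F : A) (n : ℕ) : dpow F n * F = qint ((n : ℤ) + 1) • dpow F (n + 1) := by
  have := aux_qfact_ne n
  have := aux_qint_ne n
  rw [dpow, dpow, smul_smul, smul_mul_assoc, ← pow_succ, aux_qfact_succ]
  congr 1
  field_simp

theorem aux_dpow_mul (F : A) (a b : ℕ) :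
    dpow F a * dpow F b = (qfact (a + b) / (qfact a * qfact b)) • dpow F (a + b) := by
  have := aux_qfact_ne a
  have := aux_qfact_ne b
  have := aux_qfact_ne (a + b)
  simp only [dpow, smul_mul_smul_comm, smul_smul, ← pow_add]
  congr 1
  field_simp

theorem aux_base (F x : A) (l : ℕ) (hx : SerreRel F x l) :
    x * dpow F (l + 1) = ∑ t ∈ Finset.range (l + 1),
      ((-1 : RatFunc ℚ) ^ (l + t)) • (dpow F (l + 1 - t) * x * dpow F t) := by
  unfold SerreRel at hx
  rw [Finset.sum_range_succ] at hx
  have h0 : dpow F 0 = 1 := by simp [dpow, qfact]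
  simp only [Nat.sub_self, pow_zero, one_smul, h0, one_mul] at hx
  rw [eq_neg_of_add_eq_zero_right hx, ← Finset.sum_neg_distrib]
  refine Finset.sum_congr rfl fun t ht => ?_
  have := Finset.mem_range.mp ht
  rw [← neg_smul]
  congr 1
  obtain ⟨m, rfl⟩ : ∃ m, l = t + m := ⟨l - t, by omega⟩
  rw [show t + m + 1 - t = m + 1 by omega, show t + m + t = 2 * t + m by ring, pow_add _ (2 * t), pow_mul]
  simp [pow_succ]

theorem aux_coef (l n t : ℕ) (ht : t ≤ l) :
    qint ((l : ℤ) + 1) * (qfact (n + 1 + (l + 1 - t)) / (qfact (n + 1) * qfact (l + 1 - t)))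
      - qint t * qbinom ((l : ℤ) + n + 1 - t) n
      = qint (((l + 1 + n : ℕ) : ℤ) + 1) * qbinom ((l : ℤ) + (n + 1 : ℕ) - t) (n + 1) := by
  obtain ⟨m, rfl⟩ : ∃ m, l = t + m := ⟨l - t, by omega⟩
  rw [aux_qbinom n (m + 1) _ (by push_cast; ring), aux_qbinom (n + 1) m _ (by push_cast; ring),
    show t + m + 1 - t = m + 1 by omega, show n + 1 + (m + 1) = (n + m + 1) + 1 by ring,
    show n + (m + 1) = n + m + 1 by ring, show n + 1 + m = n + m + 1 by ring,
    aux_qfact_succ (n + m + 1), aux_qfact_succ n, aux_qfact_succ m]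
  have h := aux_qint_identity ((m : ℤ) + 1) t ((n : ℤ) + 1)
  have := aux_qfact_ne n
  have := aux_qfact_ne m
  have := aux_qint_ne n
  have := aux_qint_ne m
  rw [show (((t + m : ℕ) : ℤ) + 1) = (m : ℤ) + 1 + t by push_cast; ring,
    show (((n + m + 1 : ℕ) : ℤ) + 1) = (n : ℤ) + 1 + (m + 1) by push_cast; ring,
    show (((t + m + 1 + n : ℕ) : ℤ) + 1) = (m : ℤ) + 1 + t + (n + 1) by push_cast; ring]
  generalize qint ((m : ℤ) + 1 + t) = p1 at *
  generalize qint ((n : ℤ) + 1 + (m + 1)) = p2 at *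
  generalize qint ((m : ℤ) + 1 + t + (n + 1)) = p3 at *
  generalize qint (t : ℤ) = p4 at *
  generalize qint ((m : ℤ) + 1) = p5 at *
  generalize qint ((n : ℤ) + 1) = p6 at *
  field_simp
  linear_combination qfact (n + m + 1) * h

end

theorem serre_moving_divided_powers {A : Type*} [Ring A] [Algebra (RatFunc ℚ) A]
    (F x : A) (l : ℕ) (hx : SerreRel F x l) (n : ℕ) :
    x * dpow F (l + 1 + n)
      = ∑ t ∈ Finset.range (l + 1),
          ((-1 : RatFunc ℚ) ^ (l + t) * qbinom ((l : ℤ) + n - t) n) •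
            (dpow F (l + 1 + n - t) * x * dpow F t) := by
  have hb := aux_base F x l hx
  induction n with
  | zero => simpa [qbinom, qfact] using hb
  | succ n ih =>
    have hN := aux_qint_ne (l + 1 + n)
    refine smul_right_injective A hN ?_
    change qint _ • _ = qint _ • _
    rw [← add_assoc, ← mul_smul_comm, ← aux_dpow_succ, ← mul_assoc, ih, Finset.sum_mul]
    let f : ℕ → A := fun t => (-((-1 : RatFunc ℚ) ^ (l + t)) *
      (qint t * qbinom ((l : ℤ) + n + 1 - t) n)) • (dpow F (l + 1 + n + 1 - t) * x * dpow F t)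
    have h1 : ∀ t ∈ Finset.range (l + 1),
        ((-1 : RatFunc ℚ) ^ (l + t) * qbinom ((l : ℤ) + n - t) n) •
            (dpow F (l + 1 + n - t) * x * dpow F t) * F = f (t + 1) := by
      intro t ht
      simp only [f]
      rw [smul_mul_assoc, mul_assoc _ _ F, aux_dpow_succ, mul_smul_comm, smul_smul,
        show l + 1 + n + 1 - (t + 1) = l + 1 + n - t by omega]
      congr 1
      rw [show (l : ℤ) + n + 1 - (t + 1 : ℕ) = l + n - t by push_cast; ring]
      push_cast
      ring
    have f0 : f 0 = 0 := by simp [f, aux_qint_zero]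
    have h2 : ∑ t ∈ Finset.range (l + 1), f (t + 1)
        = ∑ t ∈ Finset.range (l + 1), f t + f (l + 1) := by
      rw [← Finset.sum_range_succ, Finset.sum_range_succ' f, f0, add_zero]
    have h3 : f (l + 1) = ∑ t ∈ Finset.range (l + 1),
        ((-1 : RatFunc ℚ) ^ (l + t) * (qint ((l : ℤ) + 1) *
          (qfact (n + 1 + (l + 1 - t)) / (qfact (n + 1) * qfact (l + 1 - t))))) •
            (dpow F (l + 1 + n + 1 - t) * x * dpow F t) := by
      simp only [f]
      rw [show l + 1 + n + 1 - (l + 1) = n + 1 by omega, mul_assoc (dpow F (n + 1)), hb,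
        Finset.mul_sum, Finset.smul_sum]
      refine Finset.sum_congr rfl fun t ht => ?_
      have := Finset.mem_range.mp ht
      rw [mul_smul_comm, ← mul_assoc (dpow F (n + 1)), ← mul_assoc (dpow F (n + 1)), aux_dpow_mul,
        show n + 1 + (l + 1 - t) = l + 1 + n + 1 - t by omega, smul_mul_assoc, smul_mul_assoc,
        smul_smul, smul_smul, aux_qbinom n 0 _ (by push_cast; ring)]
      congr 1
      have := aux_qfact_ne n
      have e : (-1 : RatFunc ℚ) ^ (l + (l + 1)) = -1 := Odd.neg_one_pow ⟨l, by ring⟩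
      rw [e, show qfact 0 = 1 by simp [qfact]]
      push_cast
      simp only [add_zero, mul_one, div_self this]
      ring
    rw [Finset.sum_congr rfl h1, h2, h3, ← Finset.sum_add_distrib, Finset.smul_sum]
    refine Finset.sum_congr rfl fun t ht => ?_
    have := Finset.mem_range.mp ht
    simp only [f]
    rw [← add_smul, smul_smul]
    congr 1
    have h := aux_coef l n t (by omega)
    linear_combination (-1 : RatFunc ℚ) ^ (l + t) * h
end

section
/- For all nonnegative integers a, b, c, the following identity of q-binomial coefficients holds in the field ℚ(q): Σ_{s=0}^{c} (−1)^s · q^{(s²+s)/2 − cs} · qbinom(b+s, s) · qbinom(a+s, c) · qbinom(b+c+1, c−s) = q^{bc+c} · qbinom(a−b−1, c). -/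
/-- The `q`-analogue `[n]_q = (1 - q^n)/(1 - q)` of `n : ℤ`, in the field `ℚ(q)`
of rational functions over `ℚ` (with `q = RatFunc.X`). -/
noncomputable def qaint (n : ℤ) : RatFunc ℚ :=
  (1 - RatFunc.X ^ n) / (1 - RatFunc.X)

/-- The `q`-factorial `[n]_q! = [n]_q ⋯ [1]_q`, with `[0]_q! = 1`. -/
noncomputable def qafact (n : ℕ) : RatFunc ℚ :=
  ∏ i ∈ Finset.range n, qaint (i + 1)

/-- The `q`-binomial coefficient `qbinom(n, k) = [n]_q [n-1]_q ⋯ [n-k+1]_q / [k]_q!`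
for `n : ℤ` and `k : ℕ`. -/
noncomputable def qabinom (n : ℤ) (k : ℕ) : RatFunc ℚ :=
  (∏ i ∈ Finset.range k, qaint (n - i)) / qafact k

lemma qaux_X_ne : (RatFunc.X : RatFunc ℚ) ≠ 0 := RatFunc.X_ne_zero

lemma qaux_pow_ne (n : ℕ) (hn : n ≠ 0) : (RatFunc.X : RatFunc ℚ) ^ n ≠ 1 := by
  intro h
  have h2 : algebraMap (Polynomial ℚ) (RatFunc ℚ) (Polynomial.X ^ n)
      = algebraMap (Polynomial ℚ) (RatFunc ℚ) 1 := by
    simpa [RatFunc.algebraMap_X] using h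
  have h3 := RatFunc.algebraMap_injective ℚ h2
  have h4 := congrArg Polynomial.natDegree h3
  simp at h4
  exact hn h4

lemma qaux_zpow_ne (n : ℕ) (hn : n ≠ 0) : 1 - (RatFunc.X : RatFunc ℚ) ^ (n : ℤ) ≠ 0 := by
  rw [zpow_natCast]
  exact sub_ne_zero.2 (qaux_pow_ne n hn).symm

lemma qaux_one_sub : 1 - (RatFunc.X : RatFunc ℚ) ≠ 0 := by
  simpa using qaux_zpow_ne 1 one_ne_zero

lemma qaux_binom (n : ℤ) (k : ℕ) :
    qabinom n k = ∏ i ∈ Finset.range k,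
      (1 - (RatFunc.X : RatFunc ℚ) ^ (n - i)) / (1 - RatFunc.X ^ ((i : ℤ) + 1)) := by
  unfold qabinom qafact qaint
  rw [← Finset.prod_div_distrib]
  refine Finset.prod_congr rfl fun i _ => ?_
  rw [div_div_div_cancel_right₀ qaux_one_sub]

lemma qaux_erase (f : ℕ → RatFunc ℚ) (s n : ℕ) :
    ∏ j ∈ (Finset.range (s + 1 + n)).erase s, f j
      = (∏ j ∈ Finset.range s, f j) * ∏ i ∈ Finset.range n, f (s + 1 + i) := by
  have h1 : ∏ j ∈ (Finset.range (s + 1 + n)).erase s, f j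
      = ∏ j ∈ (Finset.range (s + 1 + n)).erase s, Function.update f s 1 j := by
    refine Finset.prod_congr rfl fun j hj => ?_
    rw [Function.update_of_ne (Finset.ne_of_mem_erase hj)]
  rw [h1, Finset.prod_erase _ (by simp), Finset.prod_range_add, Finset.prod_range_succ]
  simp only [Function.update_self, mul_one]
  congr 1
  · refine Finset.prod_congr rfl fun j hj => ?_
    rw [Function.update_of_ne (Finset.mem_range.1 hj).ne]
  · refine Finset.prod_congr rfl fun j hj => ?_
    rw [Function.update_of_ne (by omega)]

lemma qaux_powprod (b s : ℕ) :
    ∏ j ∈ Finset.range s, (RatFunc.X : RatFunc ℚ) ^ (-(b : ℤ) - 1 - j)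
      = RatFunc.X ^ ((s : ℤ) - (b + 1) * s - ((s : ℤ) ^ 2 + s) / 2) := by
  induction s with
  | zero => simp
  | succ s ih =>
    rw [Finset.prod_range_succ, ih, ← zpow_add₀ qaux_X_ne]
    congr 1
    have : (((s + 1 : ℕ) : ℤ) ^ 2 + ((s + 1 : ℕ) : ℤ)) / 2 = ((s : ℤ) ^ 2 + s) / 2 + (s + 1) := by
      rw [← Int.add_mul_ediv_right _ _ (by norm_num : (2 : ℤ) ≠ 0)]
      congr 1
      push_cast
      ring
    rw [this]
    push_cast
    ring

lemma qaux_low (b s : ℕ) :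
    ∏ j ∈ Finset.range s, (((RatFunc.X : RatFunc ℚ) ^ (s : ℤ) - RatFunc.X ^ (j : ℤ))⁻¹ *
        (RatFunc.X ^ (-(b : ℤ) - 1) - RatFunc.X ^ (j : ℤ)))
      = (-1) ^ s * RatFunc.X ^ ((s : ℤ) - (b + 1) * s - ((s : ℤ) ^ 2 + s) / 2) *
        qabinom ((b : ℤ) + s) s := by
  have hm : ((-1 : RatFunc ℚ)) ^ s = ∏ j ∈ Finset.range s, (-1 : RatFunc ℚ) := by simp
  rw [← qaux_powprod, qaux_binom, hm, ← Finset.prod_range_reflect (fun i : ℕ =>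
    (1 - (RatFunc.X : RatFunc ℚ) ^ ((b : ℤ) + s - i)) / (1 - RatFunc.X ^ ((i : ℤ) + 1))),
    ← Finset.prod_mul_distrib, ← Finset.prod_mul_distrib]
  refine Finset.prod_congr rfl fun j hj => ?_
  have hj := Finset.mem_range.1 hj
  obtain ⟨d, rfl⟩ : ∃ d, s = j + 1 + d := ⟨s - (j + 1), by omega⟩
  have e : j + 1 + d - 1 - j = d := by omega
  rw [e]
  have hne := qaux_zpow_ne (d + 1) (by omega)
  have e1 : (RatFunc.X : RatFunc ℚ) ^ ((j + 1 + d : ℕ) : ℤ) - RatFunc.X ^ (j : ℤ)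
      = - (RatFunc.X ^ (j : ℤ) * (1 - RatFunc.X ^ ((d + 1 : ℕ) : ℤ))) := by
    rw [mul_sub, ← zpow_add₀ qaux_X_ne]
    push_cast
    ring_nf
  have e2 : (RatFunc.X : RatFunc ℚ) ^ (-(b : ℤ) - 1) - RatFunc.X ^ (j : ℤ)
      = RatFunc.X ^ (j : ℤ) * (RatFunc.X ^ (-(b : ℤ) - 1 - j) *
        (1 - RatFunc.X ^ ((b : ℤ) + ((j + 1 + d : ℕ) : ℤ) - d))) := by
    rw [mul_sub, mul_sub, mul_one, ← zpow_add₀ qaux_X_ne, ← zpow_add₀ qaux_X_ne,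
      ← zpow_add₀ qaux_X_ne]
    push_cast
    congr 2 <;> ring
  rw [e1, e2]
  have hX := zpow_ne_zero (j : ℤ) qaux_X_ne
  push_cast at hne ⊢
  generalize (RatFunc.X : RatFunc ℚ) ^ (j : ℤ) = A at *
  generalize (1 - (RatFunc.X : RatFunc ℚ) ^ ((d : ℤ) + 1)) = B at *
  field_simp

lemma qaux_high (b s n : ℕ) :
    ∏ i ∈ Finset.range n,
        (((RatFunc.X : RatFunc ℚ) ^ (s : ℤ) - RatFunc.X ^ ((s + 1 + i : ℕ) : ℤ))⁻¹ *
        (RatFunc.X ^ (-(b : ℤ) - 1) - RatFunc.X ^ ((s + 1 + i : ℕ) : ℤ)))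
      = RatFunc.X ^ ((-(b : ℤ) - 1 - s) * n) *
        qabinom ((b : ℤ) + (s + n : ℕ) + 1) n := by
  have hm : (RatFunc.X : RatFunc ℚ) ^ ((-(b : ℤ) - 1 - s) * n)
      = ∏ j ∈ Finset.range n, (RatFunc.X : RatFunc ℚ) ^ (-(b : ℤ) - 1 - s) := by
    simp [zpow_mul]
  rw [qaux_binom, hm, Finset.prod_div_distrib, ← Finset.prod_range_reflect (fun i : ℕ =>
    (1 - (RatFunc.X : RatFunc ℚ) ^ ((b : ℤ) + (s + n : ℕ) + 1 - i))),
    ← Finset.prod_div_distrib, ← Finset.prod_mul_distrib]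
  refine Finset.prod_congr rfl fun j hj => ?_
  have hj := Finset.mem_range.1 hj
  obtain ⟨d, rfl⟩ : ∃ d, n = j + 1 + d := ⟨n - (j + 1), by omega⟩
  have e : j + 1 + d - 1 - j = d := by omega
  rw [e]
  have hne := qaux_zpow_ne (j + 1) (by omega)
  have e1 : (RatFunc.X : RatFunc ℚ) ^ (s : ℤ) - RatFunc.X ^ ((s + 1 + j : ℕ) : ℤ)
      = RatFunc.X ^ (s : ℤ) * (1 - RatFunc.X ^ ((j + 1 : ℕ) : ℤ)) := by
    rw [mul_sub, ← zpow_add₀ qaux_X_ne]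
    push_cast
    ring_nf
  have e2 : (RatFunc.X : RatFunc ℚ) ^ (-(b : ℤ) - 1) - RatFunc.X ^ ((s + 1 + j : ℕ) : ℤ)
      = RatFunc.X ^ (s : ℤ) * (RatFunc.X ^ (-(b : ℤ) - 1 - s) *
        (1 - RatFunc.X ^ ((b : ℤ) + ((s + (j + 1 + d) : ℕ) : ℤ) + 1 - d))) := by
    rw [mul_sub, mul_sub, mul_one, ← zpow_add₀ qaux_X_ne, ← zpow_add₀ qaux_X_ne,
      ← zpow_add₀ qaux_X_ne]
    push_cast
    congr 2 <;> ring
  rw [e1, e2]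
  have hX := zpow_ne_zero (s : ℤ) qaux_X_ne
  push_cast at hne ⊢
  generalize (RatFunc.X : RatFunc ℚ) ^ (s : ℤ) = A at *
  generalize (1 - (RatFunc.X : RatFunc ℚ) ^ ((j : ℤ) + 1)) = B at *
  field_simp

/-- The polynomial to be interpolated. -/
noncomputable def qauxP (a c : ℕ) : Polynomial (RatFunc ℚ) :=
  ∏ i ∈ Finset.range c,
    (Polynomial.C (-(RatFunc.X ^ ((a : ℤ) - i) / (1 - RatFunc.X ^ ((i : ℤ) + 1)))) * Polynomial.X
      + Polynomial.C (1 / (1 - RatFunc.X ^ ((i : ℤ) + 1))))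

lemma qauxP_degree (a c : ℕ) : (qauxP a c).degree < ((c + 1 : ℕ) : WithBot ℕ) := by
  refine lt_of_le_of_lt (b := ((c : ℕ) : WithBot ℕ)) ?_ (by exact_mod_cast Nat.lt_succ_self c)
  refine (Polynomial.degree_prod_le _ _).trans ?_
  refine (Finset.sum_le_sum fun i _ => Polynomial.degree_linear_le).trans ?_
  simp

lemma qauxP_eval (a c : ℕ) (m : ℤ) :
    (qauxP a c).eval (RatFunc.X ^ m) = qabinom ((a : ℤ) + m) c := by
  rw [qaux_binom, qauxP, Polynomial.eval_prod]
  refine Finset.prod_congr rfl fun i _ => ?_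
  have : (RatFunc.X : RatFunc ℚ) ^ ((a : ℤ) + m - i) = RatFunc.X ^ ((a : ℤ) - i) * RatFunc.X ^ m := by
    rw [← zpow_add₀ qaux_X_ne]
    ring_nf
  rw [this]
  simp only [Polynomial.eval_add, Polynomial.eval_mul, Polynomial.eval_C, Polynomial.eval_X]
  ring

lemma qaux_inj (t : Set ℕ) : Set.InjOn (fun s : ℕ => (RatFunc.X : RatFunc ℚ) ^ (s : ℤ)) t := by
  have key : ∀ x d : ℕ, (RatFunc.X : RatFunc ℚ) ^ (x : ℤ) = RatFunc.X ^ ((x + d : ℕ) : ℤ) → d = 0 := by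
    intro x d h
    by_contra hd
    rw [zpow_natCast, zpow_natCast, pow_add] at h
    exact qaux_pow_ne d hd (mul_left_cancel₀ (pow_ne_zero x qaux_X_ne) (by rw [← h, mul_one]))
  intro x _ y _ h
  simp only at h
  rcases le_total x y with hxy | hxy
  · obtain ⟨d, rfl⟩ := Nat.exists_eq_add_of_le hxy
    have := key x d h
    omega
  · obtain ⟨d, rfl⟩ := Nat.exists_eq_add_of_le hxy
    have := key y d h.symm
    omega

/-- For all nonnegative integers `a, b, c`:
`Σ_{s=0}^{c} (-1)^s q^{(s²+s)/2 - cs} qbinom(b+s, s) qbinom(a+s, c) qbinom(b+c+1, c-s)`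
`= q^{bc+c} qbinom(a-b-1, c)` in `ℚ(q)`. -/
theorem q_triple_binomial_identity (a b c : ℕ) :
    ∑ s ∈ Finset.range (c + 1),
        (-1 : RatFunc ℚ) ^ s * RatFunc.X ^ ((((s : ℤ) ^ 2 + s) / 2) - (c : ℤ) * s) *
          qabinom ((b : ℤ) + s) s * qabinom ((a : ℤ) + s) c *
            qabinom ((b : ℤ) + c + 1) (c - s)
      = RatFunc.X ^ ((b : ℤ) * c + c) * qabinom ((a : ℤ) - b - 1) c := by
  have hP := Lagrange.eq_interpolate (s := Finset.range (c + 1)) (f := qauxP a c)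
    (qaux_inj _) (by simpa using qauxP_degree a c)
  have hE := congrArg (Polynomial.eval ((RatFunc.X : RatFunc ℚ) ^ (-(b : ℤ) - 1))) hP
  rw [qauxP_eval, Lagrange.interpolate_apply, Polynomial.eval_finsetSum] at hE
  have e0 : (a : ℤ) - b - 1 = a + (-(b : ℤ) - 1) := by ring
  rw [e0, hE, Finset.mul_sum]
  refine Finset.sum_congr rfl fun s hs => ?_
  obtain ⟨n, rfl⟩ : ∃ n, c = s + n := ⟨c - s, by have := Finset.mem_range.1 hs; omega⟩
  have e1 : s + n + 1 = s + 1 + n := by omega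
  have e2 : s + n - s = n := by omega
  rw [Polynomial.eval_mul, Polynomial.eval_C, qauxP_eval, Lagrange.basis, Polynomial.eval_prod, e1,
    qaux_erase, e2]
  simp only [Lagrange.basisDivisor, Polynomial.eval_mul, Polynomial.eval_C, Polynomial.eval_sub,
    Polynomial.eval_X]
  rw [qaux_low, qaux_high]
  have hpow : (RatFunc.X : RatFunc ℚ) ^ ((((s : ℤ) ^ 2 + s) / 2) - ((s + n : ℕ) : ℤ) * s)
      = RatFunc.X ^ ((b : ℤ) * (s + n : ℕ) + (s + n : ℕ)) *
        RatFunc.X ^ ((s : ℤ) - (b + 1) * s - ((s : ℤ) ^ 2 + s) / 2) *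
        RatFunc.X ^ ((-(b : ℤ) - 1 - s) * n) := by
    rw [← zpow_add₀ qaux_X_ne, ← zpow_add₀ qaux_X_ne]
    congr 1
    have h2 : 2 * (((s : ℤ) ^ 2 + s) / 2) = (s : ℤ) ^ 2 + s := by
      apply Int.mul_ediv_cancel'
      have := (Int.even_mul_succ_self (s : ℤ)).two_dvd
      rwa [show (s : ℤ) ^ 2 + s = s * (s + 1) by ring]
    push_cast
    linear_combination h2
  rw [hpow]
  ring
end
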